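/- Let f : [0,1] → ℝ be a polynomial of degree at most N, let K ≥ 2 be an integer, and let T be the quantized tensor representation of f on D_K. Then the matrix product state S := A_L A^{K−2} A_R, defined by S(σ_{1:K}) := Σ_{α_1,…,α_{K−1} ∈ {0,…,N}} A_L^{1,α_1}(σ_1) A^{α_1 α_2}(σ_2) ⋯ A^{α_{K−2} α_{K−1}}(σ_{K−1}) A_R^{α_{K−1},1}(σ_K), satisfies S(σ_{1:K}) = T(σ_{1:K}) for all σ_{1:K} ∈ {0,1}^K. -/

import Mathlib

noncomputable section

/-- The Chebyshev–Lobatto node `c_N^α = (cos(πα/N)+1)/2`, shifted and scaled to `[0,1]`. -/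
def chebNode (N α : ℕ) : ℝ := (Real.cos (Real.pi * α / N) + 1) / 2

/-- The Lagrange cardinal polynomial `P_N^α` for the Chebyshev–Lobatto grid. -/
def chebP (N α : ℕ) (x : ℝ) : ℝ :=
  ∏ β ∈ (Finset.range (N + 1)).erase α,
    (x - chebNode N β) / (chebNode N α - chebNode N β)

/-- The real value of a bit. -/
def bitVal (b : Bool) : ℝ := if b then 1 else 0

/-- The quantized tensor representation of `f` on the dyadic grid `D_K`. -/
def qtt (f : ℝ → ℝ) (K : ℕ) (σ : Fin K → Bool) : ℝ :=
  f (∑ k : Fin K, (2 : ℝ) ^ (-(k.val + 1 : ℤ)) * bitVal (σ k))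

/-- The repeated contraction `A^p` of the Chebyshev interpolating core
`A^{αβ}(σ) = P_N^α((σ + c_N^β)/2)`, with the convention `A^0 = Id`. -/
def Apow (N : ℕ) : (p : ℕ) → (Fin p → Bool) → ℕ → ℕ → ℝ
  | 0, _, α, β => if α = β then 1 else 0
  | p + 1, σ, α, β => ∑ γ ∈ Finset.range (N + 1),
      Apow N p (fun i => σ i.castSucc) α γ *
        chebP N γ ((bitVal (σ (Fin.last p)) + chebNode N β) / 2)

theorem chebNode_mem_Icc (N α : ℕ) : chebNode N α ∈ Set.Icc (0 : ℝ) 1 := by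
  have h₁ := Real.neg_one_le_cos (Real.pi * α / N)
  have h₂ := Real.cos_le_one (Real.pi * α / N)
  constructor <;> unfold chebNode <;> linarith

theorem chebNode_injOn {N : ℕ} (hN : 1 ≤ N) :
    Set.InjOn (chebNode N) (Finset.range (N + 1)) := by
  have hN' : (0 : ℝ) < N := by exact_mod_cast hN
  have angle_mem : ∀ α ∈ Finset.range (N + 1),
      Real.pi * (α : ℝ) / N ∈ Set.Icc (0 : ℝ) Real.pi := by
    intro α hα
    have hα' : (α : ℝ) ≤ N := by
      exact_mod_cast Nat.lt_succ_iff.mp (Finset.mem_range.mp hα)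
    refine ⟨by positivity, ?_⟩
    rw [div_le_iff₀ hN']
    exact mul_le_mul_of_nonneg_left hα' Real.pi_pos.le
  intro α hα β hβ h
  have hcos : Real.cos (Real.pi * α / N) = Real.cos (Real.pi * β / N) := by
    unfold chebNode at h
    linarith
  have hang := Real.injOn_cos (angle_mem α hα) (angle_mem β hβ) hcos
  rw [div_left_inj' hN'.ne'] at hang
  exact_mod_cast mul_left_cancel₀ Real.pi_ne_zero hang

theorem eval_lagrangeBasis_chebNode (N α : ℕ) (x : ℝ) :
    (Lagrange.basis (Finset.range (N + 1)) (chebNode N) α).eval x = chebP N α x := by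
  simp only [Lagrange.basis, Lagrange.basisDivisor, chebP, Polynomial.eval_prod]
  refine Finset.prod_congr rfl fun β _ => ?_
  simp [div_eq_inv_mul]

/-- Chebyshev–Lobatto interpolation is exact on polynomials of degree at most `N`. -/
theorem sum_eval_chebNode_mul_chebP {N : ℕ} (hN : 1 ≤ N) {Q : Polynomial ℝ}
    (hQ : Q.natDegree ≤ N) (x : ℝ) :
    ∑ α ∈ Finset.range (N + 1), Q.eval (chebNode N α) * chebP N α x = Q.eval x := by
  have hdeg : Q.degree < (Finset.range (N + 1)).card := by
    rw [Finset.card_range]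
    exact Polynomial.degree_le_natDegree.trans_lt (by exact_mod_cast Nat.lt_succ_of_le hQ)
  conv_rhs => rw [Lagrange.eq_interpolate (chebNode_injOn hN) hdeg]
  simp [Lagrange.interpolate_apply, Polynomial.eval_finsetSum, eval_lagrangeBasis_chebNode]

/-- The number whose binary expansion starts with the digits `σ` and whose remainder,
rescaled to the unit interval, is `c`. -/
def dyadicPoint (p : ℕ) (σ : Fin p → Bool) (c : ℝ) : ℝ :=
  ∑ k : Fin p, (2 : ℝ) ^ (-(k.val + 1 : ℤ)) * bitVal (σ k) + (2 : ℝ) ^ (-(p : ℤ)) * c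

theorem two_zpow_neg_add_one (k : ℤ) : (2 : ℝ) ^ (-(k + 1)) = 2 ^ (-k) / 2 := by
  rw [neg_add, zpow_add₀ two_ne_zero, zpow_neg_one, div_eq_mul_inv]

theorem dyadicPoint_castSucc (p : ℕ) (σ : Fin (p + 1) → Bool) (c : ℝ) :
    dyadicPoint (p + 1) σ c =
      dyadicPoint p (fun i => σ i.castSucc) ((bitVal (σ (Fin.last p)) + c) / 2) := by
  simp only [dyadicPoint, Fin.sum_univ_castSucc, Fin.val_castSucc, Fin.val_last,
    Nat.cast_add, Nat.cast_one, two_zpow_neg_add_one (p : ℤ)]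
  ring

theorem dyadicPoint_succ (p : ℕ) (σ : Fin (p + 1) → Bool) (c : ℝ) :
    dyadicPoint (p + 1) σ c =
      (bitVal (σ 0) + dyadicPoint p (fun i => σ i.succ) c) / 2 := by
  simp only [dyadicPoint, Fin.sum_univ_succ, Fin.val_zero, Fin.val_succ,
    Nat.cast_add, Nat.cast_one, Nat.cast_zero, two_zpow_neg_add_one]
  simp only [add_div, Finset.sum_div, neg_zero, zpow_zero]
  ring_nf

theorem half_bitVal_add_mem_Icc (b : Bool) {c : ℝ} (hc : c ∈ Set.Icc (0 : ℝ) 1) :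
    (bitVal b + c) / 2 ∈ Set.Icc (0 : ℝ) 1 := by
  obtain ⟨h₀, h₁⟩ := hc
  cases b <;> constructor <;> simp [bitVal] <;> linarith

theorem dyadicPoint_mem_Icc (p : ℕ) (σ : Fin p → Bool) {c : ℝ}
    (hc : c ∈ Set.Icc (0 : ℝ) 1) : dyadicPoint p σ c ∈ Set.Icc (0 : ℝ) 1 := by
  induction p with
  | zero => simpa [dyadicPoint] using hc
  | succ p ih =>
    rw [dyadicPoint_succ]
    exact half_bitVal_add_mem_Icc _ (ih _)

theorem natDegree_comp_affine_le (Q : Polynomial ℝ) (a b : ℝ) :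
    (Q.comp (Polynomial.C a * Polynomial.X + Polynomial.C b)).natDegree ≤ Q.natDegree :=
  Polynomial.natDegree_comp_le.trans
    (mul_le_of_le_one_right (Nat.zero_le _) Polynomial.natDegree_linear_le)

/-- Contracting nodal values of a polynomial with the interpolating cores and then
interpolating evaluates the polynomial at the corresponding dyadic point. -/
theorem sum_eval_mul_Apow_mul_chebP {N : ℕ} (hN : 1 ≤ N) {Q : Polynomial ℝ}
    (hQ : Q.natDegree ≤ N) (p : ℕ) (σ : Fin p → Bool) (x : ℝ) :
    ∑ α ∈ Finset.range (N + 1), ∑ β ∈ Finset.range (N + 1),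
      Q.eval (chebNode N α) * Apow N p σ α β * chebP N β x = Q.eval (dyadicPoint p σ x) := by
  have contract : ∀ β ∈ Finset.range (N + 1),
      ∑ α ∈ Finset.range (N + 1), Q.eval (chebNode N α) * Apow N p σ α β =
        Q.eval (dyadicPoint p σ (chebNode N β)) := by
    cases p with
    | zero =>
      intro β hβ
      simp only [Apow, mul_ite, mul_one, mul_zero, Finset.sum_ite_eq', hβ, if_true]
      simp [dyadicPoint]
    | succ p =>
      intro β _
      rw [dyadicPoint_castSucc, ← sum_eval_mul_Apow_mul_chebP hN hQ p]
      simp only [Apow, Finset.mul_sum, mul_assoc]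
  have hcomp : ∀ c, Q.eval (dyadicPoint p σ c) =
      (Q.comp (Polynomial.C ((2 : ℝ) ^ (-(p : ℤ))) * Polynomial.X +
        Polynomial.C (dyadicPoint p σ 0))).eval c := by
    intro c
    simp only [Polynomial.eval_comp, Polynomial.eval_add, Polynomial.eval_mul,
      Polynomial.eval_C, Polynomial.eval_X, dyadicPoint, mul_zero, add_zero]
    rw [add_comm]
  rw [Finset.sum_comm, hcomp,
    ← sum_eval_chebNode_mul_chebP hN ((natDegree_comp_affine_le Q _ _).trans hQ)]
  refine Finset.sum_congr rfl fun β hβ => ?_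
  rw [← Finset.sum_mul, contract β hβ, hcomp]

theorem qtt_eq_dyadicPoint_zero (f : ℝ → ℝ) (K : ℕ) (σ : Fin K → Bool) :
    qtt f K σ = f (dyadicPoint K σ 0) := by
  simp [qtt, dyadicPoint]

/-- if `f : [0,1] → ℝ` is a polynomial of degree at most `N`, then the
matrix product state `S = A_L A^{K-2} A_R` equals the quantized tensor representation
`T` of `f` on `D_K` exactly. -/
theorem stmt10 (N : ℕ) (hN : 1 ≤ N) (P : Polynomial ℝ) (hP : P.degree ≤ N)
    (f : ℝ → ℝ) (hf : ∀ x ∈ Set.Icc (0 : ℝ) 1, f x = P.eval x)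
    (K : ℕ) (hK : 2 ≤ K) :
    ∀ σ : Fin K → Bool,
      (∑ α ∈ Finset.range (N + 1), ∑ β ∈ Finset.range (N + 1),
          f ((bitVal (σ ⟨0, by omega⟩) + chebNode N α) / 2) *
            Apow N (K - 2) (fun i => σ ⟨i.val + 1, by have := i.isLt; omega⟩) α β *
            chebP N β (bitVal (σ ⟨K - 1, by omega⟩) / 2)) = qtt f K σ := by
  intro σ
  obtain ⟨m, rfl⟩ := Nat.exists_eq_add_of_le' hK
  have hcomp : ∀ c, (P.comp (Polynomial.C (1 / 2) * Polynomial.X +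
      Polynomial.C (bitVal (σ 0) / 2))).eval c = P.eval ((bitVal (σ 0) + c) / 2) := by
    intro c
    simp only [Polynomial.eval_comp, Polynomial.eval_add, Polynomial.eval_mul,
      Polynomial.eval_C, Polynomial.eval_X]
    congr 1
    ring
  have key := sum_eval_mul_Apow_mul_chebP hN
    ((natDegree_comp_affine_le P (1 / 2) (bitVal (σ 0) / 2)).trans
      (Polynomial.natDegree_le_iff_degree_le.mpr hP)) m (fun i => σ i.castSucc.succ)
      (bitVal (σ (Fin.last (m + 1))) / 2)
  simp only [hcomp] at key
  rw [qtt_eq_dyadicPoint_zero, hf _ (dyadicPoint_mem_Icc _ _ (by simp)),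
    dyadicPoint_succ, dyadicPoint_castSucc, add_zero, Fin.succ_last]
  refine Eq.trans (Finset.sum_congr rfl fun α _ => Finset.sum_congr rfl fun β _ => ?_) key
  rw [← hf _ (half_bitVal_add_mem_Icc _ (chebNode_mem_Icc N α))]
  rfl
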